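/- Let G be a finite group and χ a character of G (the character of a finite-dimensional complex representation). For each integer k, the Adams operation Ψ^k(χ), defined by Ψ^k(χ)(g) = χ(g^k), is a virtual character of G (an integer linear combination of irreducible characters). -/

import Mathlib

open FDRep

open Module in
/-- An endomorphism of finite order on a complex vector space has an eigenbasis. -/
theorem adams_exists_eigenbasis {M : Type} [AddCommGroup M] [Module ℂ M] [FiniteDimensional ℂ M]
    (f : M →ₗ[ℂ] M) (n : ℕ) (hn : 0 < n) (hf : f ^ n = 1) :
    ∃ (b : Basis (Fin (finrank ℂ M)) ℂ M) (d : Fin (finrank ℂ M) → ℂ), ∀ i, f (b i) = d i • b i := by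
  classical
  have hss : Module.End.IsSemisimple f := by
    apply Module.End.isSemisimple_of_squarefree_aeval_eq_zero
      (p := (Polynomial.X ^ n - 1 : Polynomial ℂ))
    · apply Polynomial.Separable.squarefree
      have := Polynomial.separable_X_pow_sub_C (F := ℂ) (n := n) 1
        (by exact_mod_cast hn.ne') one_ne_zero
      simpa using this
    · simp [hf]
  have hint : DirectSum.IsInternal (fun μ : ℂ => Module.End.eigenspace f μ) :=
    DirectSum.isInternal_submodule_of_iSupIndep_of_iSup_eq_top
      (Module.End.eigenspaces_iSupIndep f) hss.iSup_eigenspace_eq_top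
  let b0 := hint.collectedBasis (fun μ => Module.finBasis ℂ (Module.End.eigenspace f μ))
  have := FiniteDimensional.fintypeBasisIndex b0
  let e := Fintype.equivFinOfCardEq (Module.finrank_eq_card_basis b0).symm
  refine ⟨b0.reindex e, fun i => (e.symm i).1, fun i => ?_⟩
  rw [Basis.reindex_apply]
  exact Module.End.mem_eigenspace_iff.mp (hint.collectedBasis_mem _ _)

open Module in
theorem adams_trace_of_eigenbasis {M I : Type} [Fintype I] [AddCommGroup M] [Module ℂ M]
    (f : M →ₗ[ℂ] M) (b : Basis I ℂ M) (d : I → ℂ) (h : ∀ i, f (b i) = d i • b i) :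
    LinearMap.trace ℂ M f = ∑ i, d i := by
  classical
  rw [LinearMap.trace_eq_matrix_trace ℂ b, Matrix.trace]
  refine Finset.sum_congr rfl fun i _ => ?_
  simp [LinearMap.toMatrix_apply, h]

/-- Exterior power of a representation. -/
noncomputable def adamsExt {G : Type} [Group G] (V : FDRep ℂ G) (n : ℕ) :
    Representation ℂ G (⋀[ℂ]^n V) where
  toFun g := exteriorPower.map n (V.ρ g)
  map_one' := by
    rw [map_one]; exact exteriorPower.map_id
  map_mul' g h := by
    rw [map_mul]; exact exteriorPower.map_comp (V.ρ h) (V.ρ g)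

open Module in
theorem adams_trace_ext {M : Type} [AddCommGroup M] [Module ℂ M] {m : ℕ}
    (f : M →ₗ[ℂ] M) (b : Basis (Fin m) ℂ M) (d : Fin m → ℂ) (h : ∀ i, f (b i) = d i • b i)
    (n : ℕ) :
    LinearMap.trace ℂ _ (exteriorPower.map n f) =
      MvPolynomial.aeval d (MvPolynomial.esymm (Fin m) ℂ n) := by
  classical
  rw [adams_trace_of_eigenbasis (I := Set.powersetCard (Fin m) n) _ (b.exteriorPower n)
    (fun s => ∏ i ∈ (s : Finset (Fin m)), d i)]
  · rw [MvPolynomial.esymm_eq_sum_subtype, map_sum]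
    simp only [map_prod, MvPolynomial.aeval_X]
    let e : Set.powersetCard (Fin m) n ≃ {s : Finset (Fin m) // s.card = n} :=
      ⟨fun s => ⟨s.1, s.2⟩, fun s => ⟨s.1, s.2⟩, fun _ => rfl, fun _ => rfl⟩
    exact Fintype.sum_equiv e _ _ fun _ => rfl
  · intro s
    rw [exteriorPower.basis_apply, exteriorPower.ιMulti_family, exteriorPower.map_apply_ιMulti]
    have : (f ∘ fun i => b (Set.powersetCard.ofFinEmbEquiv.symm s i)) = fun i =>
      d (Set.powersetCard.ofFinEmbEquiv.symm s i) • b (Set.powersetCard.ofFinEmbEquiv.symm s i) := by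
      funext i; simp [h]
    erw [this]
    rw [AlternatingMap.map_smul_univ]
    congr 1
    obtain ⟨e, rfl⟩ := Set.powersetCard.ofFinEmbEquiv.surjective s
    rw [Equiv.symm_apply_apply, Set.powersetCard.ofFinEmbEquiv_apply,
      Set.powersetCard.val_ofFinEmb, Finset.prod_map]
    rfl

/-- The ring of virtual characters. -/
noncomputable def adamsRing (G : Type) [Group G] : Subring (G → ℂ) where
  carrier := {f | ∃ A B : FDRep ℂ G, ∀ g, f g = A.character g - B.character g}
  zero_mem' := ⟨FDRep.of (Representation.trivial ℂ G ℂ), FDRep.of (Representation.trivial ℂ G ℂ),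
    by simp⟩
  one_mem' := ⟨FDRep.of (Representation.trivial ℂ G ℂ), FDRep.of (Representation.trivial ℂ G PUnit),
    by intro g; simp [FDRep.character, Representation.trivial,
      Module.finrank_zero_of_subsingleton]⟩
  add_mem' := by
    rintro f f' ⟨A, B, h⟩ ⟨A', B', h'⟩
    refine ⟨FDRep.of (Representation.prod A.ρ A'.ρ), FDRep.of (Representation.prod B.ρ B'.ρ),
      fun g => ?_⟩
    have key : ∀ C D : FDRep ℂ G, (FDRep.of (Representation.prod C.ρ D.ρ)).character g =
      C.character g + D.character g := fun C D => LinearMap.trace_prodMap' _ _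
    rw [key, key, Pi.add_apply, h, h']; ring
  neg_mem' := by
    rintro f ⟨A, B, h⟩
    exact ⟨B, A, fun g => by simp [h]⟩
  mul_mem' := by
    rintro f f' ⟨A, B, h⟩ ⟨A', B', h'⟩
    have key : ∀ C D : FDRep ℂ G, ∀ g, (FDRep.of (Representation.tprod C.ρ D.ρ)).character g =
      C.character g * D.character g := fun C D g => LinearMap.trace_tensorProduct' _ _
    have key2 : ∀ C D : FDRep ℂ G, ∀ g, (FDRep.of (Representation.prod C.ρ D.ρ)).character g =
      C.character g + D.character g := fun C D g => LinearMap.trace_prodMap' _ _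
    refine ⟨FDRep.of (Representation.prod (FDRep.of (Representation.tprod A.ρ A'.ρ)).ρ
        (FDRep.of (Representation.tprod B.ρ B'.ρ)).ρ),
      FDRep.of (Representation.prod (FDRep.of (Representation.tprod A.ρ B'.ρ)).ρ
        (FDRep.of (Representation.tprod B.ρ A'.ρ)).ρ), fun g => ?_⟩
    rw [key2, key2, key, key, key, key, Pi.mul_apply, h, h']; ring

theorem adams_newton {G : Type} [Group G] [Fintype G] (V : FDRep ℂ G) (k : ℕ) (hk : 0 < k) (g : G) :
    V.character (g ^ k) = (-1) ^ (k + 1) * k * LinearMap.trace ℂ _ (adamsExt V k g) -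
      ∑ a ∈ Finset.HasAntidiagonal.antidiagonal k with a.1 ∈ Set.Ioo 0 k,
        (-1) ^ a.1 * LinearMap.trace ℂ _ (adamsExt V a.1 g) * V.character (g ^ a.2) := by
  obtain ⟨b, d, h⟩ := adams_exists_eigenbasis (V.ρ g) (Fintype.card G) Fintype.card_pos
    (by rw [← map_pow, pow_card_eq_one, map_one])
  have hp : ∀ j : ℕ, V.character (g ^ j) =
      MvPolynomial.aeval d (MvPolynomial.psum (Fin (Module.finrank ℂ V)) ℂ j) := by
    intro j
    have : ∀ i, V.ρ (g ^ j) (b i) = d i ^ j • b i := by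
      intro i
      induction j with
      | zero => simp
      | succ j ih => rw [pow_succ', map_mul, Module.End.mul_apply, ih, map_smul, h, smul_smul,
          pow_succ]
    exact (adams_trace_of_eigenbasis (V.ρ (g ^ j)) b _ this).trans (by simp [MvPolynomial.psum])
  have he : ∀ j : ℕ, LinearMap.trace ℂ _ (adamsExt V j g) =
      MvPolynomial.aeval d (MvPolynomial.esymm (Fin (Module.finrank ℂ V)) ℂ j) :=
    fun j => adams_trace_ext (V.ρ g) b d h j
  simp only [hp, he]
  have := congrArg (MvPolynomial.aeval d)
    (MvPolynomial.psum_eq_mul_esymm_sub_sum (Fin (Module.finrank ℂ V)) ℂ k hk)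
  simpa using this

theorem adams_ext_mem {G : Type} [Group G] (V : FDRep ℂ G) (n : ℕ) :
    (fun g => LinearMap.trace ℂ _ (adamsExt V n g)) ∈ adamsRing G := by
  refine ⟨FDRep.of (adamsExt V n), FDRep.of (Representation.trivial ℂ G PUnit), fun g => ?_⟩
  have : (FDRep.of (Representation.trivial ℂ G PUnit)).character g = 0 := by
    simp [FDRep.character, Representation.trivial, Module.finrank_zero_of_subsingleton]
  rw [this, sub_zero]
  rfl

theorem adams_mem {G : Type} [Group G] [Fintype G] (V : FDRep ℂ G) (k : ℕ) (hk : 0 < k) :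
    (fun g => V.character (g ^ k)) ∈ adamsRing G := by
  induction k using Nat.strong_induction_on with
  | _ k ih =>
    have : (fun g => V.character (g ^ k)) =
        (-1) ^ (k + 1) * (k : G → ℂ) * (fun g => LinearMap.trace ℂ _ (adamsExt V k g)) -
        ∑ a ∈ Finset.HasAntidiagonal.antidiagonal k with a.1 ∈ Set.Ioo 0 k,
        (-1) ^ a.1 * (fun g => LinearMap.trace ℂ _ (adamsExt V a.1 g)) *
          (fun g => V.character (g ^ a.2)) := by
      funext g
      rw [adams_newton V k hk g]
      simp
    rw [this]
    have hneg : ∀ j : ℕ, ((-1) ^ j : G → ℂ) ∈ adamsRing G :=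
      fun j => pow_mem (neg_mem (one_mem _)) j
    refine sub_mem (mul_mem (mul_mem (hneg _) (natCast_mem _ k)) (adams_ext_mem V k))
      (sum_mem fun a ha => mul_mem (mul_mem (hneg _) (adams_ext_mem V _)) (ih _ ?_ ?_))
    all_goals
      simp only [Finset.mem_filter, Finset.HasAntidiagonal.mem_antidiagonal, Set.mem_Ioo] at ha
      omega

theorem stmt_8 (G : Type) [Group G] [Fintype G] (V : FDRep ℂ G) (k : ℤ) :
    ∃ A B : FDRep ℂ G, ∀ g : G,
      V.character (g ^ k) = A.character g - B.character g := by
  have hc : (0 : ℤ) < Fintype.card G := by exact_mod_cast Fintype.card_pos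
  obtain ⟨m, hm0, hm⟩ : ∃ m : ℕ, 0 < m ∧ ∀ g : G, g ^ k = g ^ m := by
    have h1 := Int.emod_nonneg k hc.ne'
    refine ⟨(k % Fintype.card G).toNat + Fintype.card G, by
      have : 0 < Fintype.card G := Fintype.card_pos
      omega, fun g => ?_⟩
    rw [pow_add, pow_card_eq_one, mul_one, ← zpow_natCast, Int.toNat_of_nonneg h1]
    exact (zpow_mod_card g k).symm
  obtain ⟨A, B, h⟩ := adams_mem V m hm0
  exact ⟨A, B, fun g => by rw [hm]; exact h g⟩
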